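/- Let N ≥ 2 and let U, V be unitaries on ℂ^N ⊗ ℂ^N, with purities X_U = X(U), Y_U = Y(U), X_V = X(V), Y_V = Y(V). Let U^A, U^B be independent Haar-random unitaries on ℂ^N and set M = U·(U^A ⊗ U^B)·V. Then the Haar averages of the purities of M are: ⟨X(M)⟩ = (N²−1)^{−2}·[2(N²+1) − 2N²(X_U + Y_U + X_V + Y_V) + N⁴(X_U X_V + Y_U Y_V) + N²(Y_U X_V + X_U Y_V)], and ⟨Y(M)⟩ = (N²−1)^{−2}·[2(N²+1) − 2N²(X_U + Y_U + X_V + Y_V) + N⁴(X_U Y_V + Y_U X_V) + N²(Y_U Y_V + X_U X_V)]. -/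

import Mathlib

open Matrix MeasureTheory
open scoped Kronecker

noncomputable section

instance {m n R : Type*} [TopologicalSpace R] : MeasurableSpace (Matrix m n R) := borel _
instance {m n R : Type*} [TopologicalSpace R] : BorelSpace (Matrix m n R) := ⟨rfl⟩

/-- Reshuffling: `(U_R)_{(i,j),(α,β)} = U_{(i,α),(j,β)}`. -/
def reshuffle (N : ℕ) (U : Matrix (Fin N × Fin N) (Fin N × Fin N) ℂ) :
    Matrix (Fin N × Fin N) (Fin N × Fin N) ℂ :=
  Matrix.of fun p q => U (p.1, q.1) (p.2, q.2)

/-- Partial transpose: `(U_Γ)_{(j,α),(i,β)} = U_{(i,α),(j,β)}`. -/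
def ptransp (N : ℕ) (U : Matrix (Fin N × Fin N) (Fin N × Fin N) ℂ) :
    Matrix (Fin N × Fin N) (Fin N × Fin N) ℂ :=
  Matrix.of fun p q => U (q.1, p.2) (p.1, q.2)

/-- The swap gate `S(x ⊗ y) = y ⊗ x`. -/
def swapGate (N : ℕ) : Matrix (Fin N × Fin N) (Fin N × Fin N) ℂ :=
  Matrix.of fun p q => if p.1 = q.2 ∧ p.2 = q.1 then 1 else 0

/-- `ρ_R(U) = U_R U_R† / N²`. -/
def rhoR (N : ℕ) (U : Matrix (Fin N × Fin N) (Fin N × Fin N) ℂ) :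
    Matrix (Fin N × Fin N) (Fin N × Fin N) ℂ :=
  ((N : ℂ) ^ 2)⁻¹ • (reshuffle N U * (reshuffle N U)ᴴ)

/-- `ρ_T(U) = S U_Γ U_Γ† S / N²`. -/
def rhoT (N : ℕ) (U : Matrix (Fin N × Fin N) (Fin N × Fin N) ℂ) :
    Matrix (Fin N × Fin N) (Fin N × Fin N) ℂ :=
  ((N : ℂ) ^ 2)⁻¹ • (swapGate N * (ptransp N U * (ptransp N U)ᴴ) * swapGate N)

/-- Purity `X(U) = tr(ρ_R(U)²)` (a real number). -/
def Xpur (N : ℕ) (U : Matrix (Fin N × Fin N) (Fin N × Fin N) ℂ) : ℝ :=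
  ((rhoR N U * rhoR N U).trace).re

/-- Purity `Y(U) = tr(ρ_T(U)²)` (a real number). -/
def Ypur (N : ℕ) (U : Matrix (Fin N × Fin N) (Fin N × Fin N) ℂ) : ℝ :=
  ((rhoT N U * rhoT N U).trace).re

/-- Entangling power `e_p(U)`. -/
def ep (N : ℕ) (U : Matrix (Fin N × Fin N) (Fin N × Fin N) ℂ) : ℝ :=
  ((N : ℝ) ^ 2 / ((N : ℝ) + 1) ^ 2) *
    ((1 - Xpur N U) + (1 - Ypur N U) - ((N : ℝ) ^ 2 - 1) / (N : ℝ) ^ 2)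

/-- Gate typicality `g_t(U)`. -/
def gateTyp (N : ℕ) (U : Matrix (Fin N × Fin N) (Fin N × Fin N) ℂ) : ℝ :=
  ((N : ℝ) ^ 2 / ((N : ℝ) ^ 2 - 1)) *
    (Ypur N U - Xpur N U + ((N : ℝ) ^ 2 - 1) / (N : ℝ) ^ 2)

/-- Mean entangling power over the Haar measure, `ē_p = (N-1)²/(N²+1)`. -/
def epBar (N : ℕ) : ℝ := ((N : ℝ) - 1) ^ 2 / ((N : ℝ) ^ 2 + 1)

/-- `iterGate U W k = U · W_{k-1} · U ⋯ W_0 · U`, i.e. `U^(k+1)` with `k` interlacing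
local gates `W_0, …, W_{k-1}`. -/
def iterGate {D : Type*} [Fintype D] [DecidableEq D] (U : Matrix D D ℂ)
    (W : ℕ → Matrix D D ℂ) : ℕ → Matrix D D ℂ
  | 0 => U
  | k + 1 => U * W k * iterGate U W k

/-- The flip of the two factors of a product when the flag is set, the identity otherwise. -/
def flipIf {n : Type*} : Bool → n × n → n × n
  | true => Prod.swap
  | false => id

/-- The operators commuting with `h ⊗ h` for every unitary `h` are spanned by the identity and the
swap. -/
lemma exists_eq_of_commute_kronecker_self {n : Type*} [Fintype n] [DecidableEq n] [Nontrivial n]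
    (T : Matrix (n × n) (n × n) ℂ)
    (hT : ∀ h ∈ Matrix.unitaryGroup n ℂ, (h ⊗ₖ h) * T = T * (h ⊗ₖ h)) :
    ∃ a b : ℂ, ∀ x y, T x y = (if x = y then a else 0) + (if x.swap = y then b else 0) := by
  have hdiag : ∀ i j k l, ¬ ((i, j) = (k, l) ∨ (j, i) = (k, l)) → T (i, j) (k, l) = 0 := by
    intro i j k l hne
    by_contra h0
    have key : ∀ v : n, (if i = v then Complex.I else 1) * (if j = v then Complex.I else 1) =
        (if k = v then Complex.I else 1) * (if l = v then Complex.I else 1) := by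
      intro v
      have hd : Matrix.diagonal (fun z => if z = v then Complex.I else 1) ∈
          Matrix.unitaryGroup n ℂ := by
        rw [Matrix.mem_unitaryGroup_iff, Matrix.star_eq_conjTranspose, Matrix.diagonal_conjTranspose,
          Matrix.diagonal_mul_diagonal, ← Matrix.diagonal_one]
        congr 1
        funext z
        by_cases hz : z = v <;> simp [hz]
      have h := congrFun (congrFun (hT _ hd) (i, j)) (k, l)
      rw [Matrix.diagonal_kronecker_diagonal, Matrix.diagonal_mul, Matrix.mul_diagonal,
        mul_comm (T _ _)] at h
      exact mul_right_cancel₀ h0 h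
    have hI : Complex.I ≠ 1 := fun h => by simpa using congrArg Complex.re h
    have hI' : (-1 : ℂ) ≠ Complex.I := fun h => by simpa using congrArg Complex.re h
    have hm : (-1 : ℂ) ≠ 1 := by norm_num
    have h1 := key i
    have h2 := key j
    apply hne
    simp only [Prod.mk.injEq]
    clear key h0 hT hne
    have hII := Complex.I_mul_I
    generalize Complex.I = c at *
    by_cases hij : i = j
    · subst hij
      grind
    · grind
  have hperm : ∀ (σ : Equiv.Perm n) (i j k l : n),
      T (σ i, σ j) (σ k, σ l) = T (i, j) (k, l) := by
    intro σ i j k l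
    have hs : (σ.permMatrix ℂ) ∈ Matrix.unitaryGroup n ℂ := by
      rw [Matrix.mem_unitaryGroup_iff, Matrix.star_eq_conjTranspose, Matrix.conjTranspose_permMatrix,
        ← Matrix.permMatrix_mul]
      simp
    have h := congrFun (congrFun (hT _ hs) (i, j)) (σ k, σ l)
    simpa [Matrix.mul_apply, Equiv.Perm.permMatrix, PEquiv.toMatrix_apply, Fintype.sum_prod_type,
      ite_and] using h
  have hrot : ∀ i j : n, i ≠ j →
      T (i, i) (i, i) = T (i, j) (i, j) + T (j, i) (i, j) := by
    intro i j hij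
    set v : n → ℂ := Pi.single i (3 / 5) + Pi.single j (4 / 5) with hv
    have hvv : v ⬝ᵥ v = 1 := by
      simp [hv, hij, hij.symm]; norm_num
    have hsv : star v = v := by
      funext z
      refine Complex.conj_eq_iff_im.2 ?_
      simp only [hv, Pi.add_apply, Pi.single_apply]
      split_ifs <;> norm_num
    set h : Matrix n n ℂ := 1 - (2 : ℂ) • Matrix.vecMulVec v v with hh
    have hh2 : h ∈ Matrix.unitaryGroup n ℂ := by
      have hst : star h = h := by
        rw [hh, Matrix.star_eq_conjTranspose, Matrix.conjTranspose_sub, Matrix.conjTranspose_smul,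
          Matrix.conjTranspose_vecMulVec, hsv]
        simp
      rw [Matrix.mem_unitaryGroup_iff, hst, hh]
      have : Matrix.vecMulVec v v * Matrix.vecMulVec v v = Matrix.vecMulVec v v := by
        rw [Matrix.vecMulVec_mul_vecMulVec, hvv, one_smul]
      simp only [sub_mul, mul_sub, one_mul, mul_one, Matrix.smul_mul, Matrix.mul_smul, this]
      module
    have e := congrFun (congrFun (hT h hh2) (i, i)) (i, j)
    have hii : h i i = 7 / 25 := by
      simp [hh, hv, Matrix.vecMulVec_apply, hij]; norm_num
    have hij' : h i j = - 24 / 25 := by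
      simp [hh, hv, Matrix.vecMulVec_apply, hij, hij.symm]; norm_num
    rw [Matrix.mul_apply, Matrix.mul_apply,
      Finset.sum_eq_add (i, j) (j, i) (by simp [hij]) _ (by simp) (by simp),
      Finset.sum_eq_single (i, i) _ (by simp)] at e
    · simp only [Matrix.kroneckerMap_apply, hii, hij'] at e
      linear_combination (25 / 24 * 25 / 7 : ℂ) * e
    · rintro ⟨k, l⟩ - hkl
      rw [hdiag, zero_mul]
      simpa [eq_comm] using hkl
    · rintro ⟨k, l⟩ - ⟨h1, h2⟩
      rw [hdiag k l i j, mul_zero]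
      grind
  obtain ⟨p, q, hpq⟩ := exists_pair_ne n
  have htrans : ∀ i j : n, i ≠ j → ∃ σ : Equiv.Perm n, σ p = i ∧ σ q = j := by
    intro i j hij
    refine ⟨Equiv.swap (Equiv.swap p i q) j * Equiv.swap p i, ?_, ?_⟩
    · rw [Equiv.Perm.mul_apply, Equiv.swap_apply_left, Equiv.swap_apply_of_ne_of_ne _ hij]
      intro h
      apply hpq
      apply (Equiv.swap p i).injective
      rw [← h, Equiv.swap_apply_left]
    · rw [Equiv.Perm.mul_apply, Equiv.swap_apply_left]
  have hA : ∀ i j, i ≠ j → T (i, j) (i, j) = T (p, q) (p, q) := by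
    intro i j hij
    obtain ⟨σ, rfl, rfl⟩ := htrans i j hij
    exact hperm σ p q p q
  have hB : ∀ i j, i ≠ j → T (j, i) (i, j) = T (q, p) (p, q) := by
    intro i j hij
    obtain ⟨σ, rfl, rfl⟩ := htrans i j hij
    exact hperm σ q p p q
  refine ⟨T (p, q) (p, q), T (q, p) (p, q), ?_⟩
  rintro ⟨i, j⟩ ⟨k, l⟩
  by_cases h : (i, j) = (k, l) ∨ (j, i) = (k, l)
  · by_cases hij : i = j
    · subst hij
      obtain ⟨j, hj⟩ := exists_ne i
      have hkl : (i, i) = (k, l) := by simpa using h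
      rw [← hkl, hrot i j hj.symm, hA i j hj.symm, hB i j hj.symm]
      simp
    · rcases h with h | h
      · rw [← h, hA i j hij]
        simp [Ne.symm hij, hij]
      · rw [← h, hB j i (Ne.symm hij)]
        simp [hij]
  · rw [hdiag i j k l h]
    push Not at h
    simp [h.1, h.2]

section Haar

variable {N : ℕ}

/-- The degree two Weingarten function of `U(N)`, indexed by the two elements of `S₂`. -/
def weingarten (N : ℕ) (s t : Bool) : ℂ :=
  if s = t then ((N : ℂ) ^ 2 - 1)⁻¹ else -((N : ℂ) * ((N : ℂ) ^ 2 - 1))⁻¹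

/-- The degree `(2, 2)` monomial in the entries of `g` and their conjugates. -/
def entryMonomial (x y x' y' : Fin N × Fin N) (g : Matrix.unitaryGroup (Fin N) ℂ) : ℂ :=
  (g : Matrix (Fin N) (Fin N) ℂ) x.1 y.1 * (g : Matrix (Fin N) (Fin N) ℂ) x.2 y.2 *
    (star ((g : Matrix (Fin N) (Fin N) ℂ) x'.1 y'.1) *
      star ((g : Matrix (Fin N) (Fin N) ℂ) x'.2 y'.2))

lemma integrable_entryMonomial (μ : Measure (Matrix.unitaryGroup (Fin N) ℂ)) [IsFiniteMeasure μ]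
    (x y x' y' : Fin N × Fin N) : Integrable (entryMonomial x y x' y') μ := by
  have hc : Continuous (entryMonomial x y x' y') := by
    have he : ∀ i j, Continuous
        fun g : Matrix.unitaryGroup (Fin N) ℂ => (g : Matrix (Fin N) (Fin N) ℂ) i j :=
      fun i j => continuous_subtype_val.matrix_elem i j
    exact ((he _ _).mul (he _ _)).mul ((he _ _).star.mul (he _ _).star)
  refine Integrable.of_bound hc.aestronglyMeasurable 1 (Filter.Eventually.of_forall fun g => ?_)
  have hb : ∀ i j, ‖(g : Matrix (Fin N) (Fin N) ℂ) i j‖ ≤ 1 := entry_norm_bound_of_unitary g.2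
  simp only [entryMonomial, norm_mul, norm_star]
  have h2 : ∀ {a b : ℝ}, 0 ≤ a → a ≤ 1 → 0 ≤ b → b ≤ 1 → a * b ≤ 1 :=
    fun _ ha hb hb' => mul_le_one₀ ha hb hb'
  exact h2 (by positivity) (h2 (norm_nonneg _) (hb _ _) (norm_nonneg _) (hb _ _))
    (by positivity) (h2 (norm_nonneg _) (hb _ _) (norm_nonneg _) (hb _ _))

lemma entryMonomial_mul (h g : Matrix.unitaryGroup (Fin N) ℂ) (x y x' y' : Fin N × Fin N) :
    entryMonomial x y x' y' (h * g) =
      ∑ z, ∑ z', ((h : Matrix (Fin N) (Fin N) ℂ) ⊗ₖ (h : Matrix (Fin N) (Fin N) ℂ)) x z *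
        (entryMonomial z y z' y' g *
          star (((h : Matrix (Fin N) (Fin N) ℂ) ⊗ₖ (h : Matrix (Fin N) (Fin N) ℂ)) x' z')) := by
  simp only [entryMonomial, Submonoid.coe_mul, Matrix.mul_apply, star_sum, star_mul',
    Matrix.kroneckerMap_apply]
  rw [Finset.sum_mul_sum, Finset.sum_mul_sum, Fintype.sum_prod_type, Finset.sum_mul]
  refine Finset.sum_congr rfl fun a _ => ?_
  rw [Finset.sum_mul]
  refine Finset.sum_congr rfl fun b _ => ?_
  rw [Fintype.sum_prod_type, Finset.mul_sum]
  refine Finset.sum_congr rfl fun c _ => ?_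
  rw [Finset.mul_sum]
  refine Finset.sum_congr rfl fun d _ => ?_
  ring

lemma sum_entryMonomial_flipIf (s : Bool) (y y' : Fin N × Fin N)
    (g : Matrix.unitaryGroup (Fin N) ℂ) :
    ∑ x, entryMonomial x y (flipIf s x) y' g = if flipIf s y = y' then 1 else 0 := by
  have hg : ∀ j k, ∑ i, (g : Matrix (Fin N) (Fin N) ℂ) i j *
      star ((g : Matrix (Fin N) (Fin N) ℂ) i k) = if j = k then 1 else 0 := by
    intro j k
    have h := congrFun (congrFun (Matrix.mem_unitaryGroup_iff'.1 g.2) k) j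
    rw [Matrix.mul_apply, Matrix.one_apply] at h
    simp only [Matrix.star_apply, mul_comm (star _), eq_comm (a := k)] at h
    exact h
  obtain ⟨p, q⟩ := y
  obtain ⟨r, t⟩ := y'
  rw [Fintype.sum_prod_type]
  cases s
  · trans (if p = r then 1 else 0) * (if q = t then 1 else 0)
    · rw [← hg, ← hg, Finset.sum_mul_sum]
      refine Finset.sum_congr rfl fun a _ => Finset.sum_congr rfl fun b _ => ?_
      simp only [entryMonomial, flipIf, id]
      ring
    · simp [flipIf, ite_and]
      grind
  · trans (if p = t then 1 else 0) * (if q = r then 1 else 0)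
    · rw [← hg, ← hg, Finset.sum_mul_sum]
      refine Finset.sum_congr rfl fun a _ => Finset.sum_congr rfl fun b _ => ?_
      simp only [entryMonomial, flipIf, Prod.swap]
      ring
    · simp [flipIf, ite_and]

/-- The second moments of a Haar random unitary. -/
lemma integral_entryMonomial (hN : 2 ≤ N) (μ : Measure (Matrix.unitaryGroup (Fin N) ℂ))
    [μ.IsHaarMeasure] [IsProbabilityMeasure μ] (x y x' y' : Fin N × Fin N) :
    ∫ g, entryMonomial x y x' y' g ∂μ =
      ∑ s, ∑ t, weingarten N s t * (if flipIf s x = x' then 1 else 0) *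
        (if flipIf t y = y' then 1 else 0) := by
  have : Nontrivial (Fin N) := Fin.nontrivial_iff_two_le.2 hN
  set T : Matrix (Fin N × Fin N) (Fin N × Fin N) ℂ :=
    Matrix.of fun x x' => ∫ g, entryMonomial x y x' y' g ∂μ with hTdef
  have hT : ∀ h ∈ Matrix.unitaryGroup (Fin N) ℂ, (h ⊗ₖ h) * T = T * (h ⊗ₖ h) := by
    intro h hh
    have hu : (h ⊗ₖ h)ᴴ * (h ⊗ₖ h) = 1 := (Matrix.kronecker_mem_unitary hh hh).1
    have key : T = (h ⊗ₖ h) * (T * (h ⊗ₖ h)ᴴ) := by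
      ext x x'
      have h1 := integral_mul_left_eq_self (μ := μ) (entryMonomial x y x' y') ⟨h, hh⟩
      simp only [hTdef, Matrix.of_apply]
      rw [← h1]
      simp only [entryMonomial_mul]
      have hi : ∀ z z', Integrable (fun g => (h ⊗ₖ h) x z * (entryMonomial z y z' y' g *
          star ((h ⊗ₖ h) x' z'))) μ :=
        fun z z' => ((integrable_entryMonomial μ _ _ _ _).mul_const _).const_mul _
      rw [integral_finsetSum _ fun z _ => integrable_finsetSum _ fun z' _ => hi z z']
      rw [Matrix.mul_apply]
      refine Finset.sum_congr rfl fun z _ => ?_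
      rw [integral_finsetSum _ fun z' _ => hi z z', Matrix.mul_apply, Finset.mul_sum]
      refine Finset.sum_congr rfl fun z' _ => ?_
      rw [integral_const_mul, integral_mul_const]
      rfl
    calc (h ⊗ₖ h) * T = (h ⊗ₖ h) * (T * ((h ⊗ₖ h)ᴴ * (h ⊗ₖ h))) := by rw [hu, mul_one]
      _ = (h ⊗ₖ h) * (T * (h ⊗ₖ h)ᴴ) * (h ⊗ₖ h) := by simp only [Matrix.mul_assoc]
      _ = T * (h ⊗ₖ h) := by rw [← key]
  obtain ⟨a, b, hab⟩ := exists_eq_of_commute_kronecker_self T hT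
  have htr : ∀ s, ∑ x, T x (flipIf s x) = if flipIf s y = y' then 1 else 0 := by
    intro s
    simp only [hTdef, Matrix.of_apply]
    rw [← integral_finsetSum _ fun z _ => integrable_entryMonomial μ _ _ _ _]
    simp [sum_entryMonomial_flipIf]
  have h0 := htr false
  have h1 := htr true
  have e0 : ∑ x, T x (flipIf false x) = N ^ 2 * a + N * b := by
    simp only [hab, flipIf, id, Finset.sum_add_distrib, Fintype.sum_prod_type, Prod.swap,
      Prod.mk.injEq]
    simp [ite_and, pow_two, mul_assoc]
  have e1 : ∑ x, T x (flipIf true x) = N * a + N ^ 2 * b := by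
    simp only [hab, flipIf, Finset.sum_add_distrib, Fintype.sum_prod_type, Prod.swap,
      Prod.mk.injEq]
    simp [ite_and, pow_two, mul_assoc]
  rw [e0] at h0
  rw [e1] at h1
  have hN0 : (N : ℂ) ≠ 0 := by
    exact_mod_cast (by omega : N ≠ 0)
  have hN1 : (N : ℂ) ^ 2 - 1 ≠ 0 := by
    rw [sub_ne_zero]
    exact_mod_cast (by nlinarith : N ^ 2 ≠ 1)
  have ha : a = weingarten N false false * (if flipIf false y = y' then 1 else 0) +
      weingarten N false true * (if flipIf true y = y' then 1 else 0) := by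
    rw [← h0, ← h1]
    simp only [weingarten]
    simp
    field_simp
    ring
  have hb : b = weingarten N true false * (if flipIf false y = y' then 1 else 0) +
      weingarten N true true * (if flipIf true y = y' then 1 else 0) := by
    rw [← h0, ← h1]
    simp only [weingarten]
    simp
    field_simp
    ring
  change T x x' = _
  rw [hab x x', ha, hb]
  simp only [Fintype.sum_bool]
  have hx0 : flipIf false x = x := rfl
  have hx1 : flipIf true x = x.swap := rfl
  rw [hx0, hx1]
  split_ifs <;> ring

end Haar

section Pairing

variable {N : ℕ}

/-- The permutation of the indices of two copies of a bipartite system which flips the two copies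
of the first (second) subsystem when the first (second) flag is set. -/
def flipParts (s : Bool × Bool) (x : (Fin N × Fin N) × (Fin N × Fin N)) :
    (Fin N × Fin N) × (Fin N × Fin N) :=
  (((flipIf s.1 (x.1.1, x.2.1)).1, (flipIf s.2 (x.1.2, x.2.2)).1),
    ((flipIf s.1 (x.1.1, x.2.1)).2, (flipIf s.2 (x.1.2, x.2.2)).2))

/-- The contraction of `U ⊗ U` with its conjugate whose output and input indices are permuted
by `s` and `t`. -/
def pairing (U : Matrix (Fin N × Fin N) (Fin N × Fin N) ℂ) (s t : Bool × Bool) : ℂ :=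
  ∑ x, ∑ y, (U ⊗ₖ U) x y * star ((U ⊗ₖ U) (flipParts s x) (flipParts t y))

/-- The tensor product of two unitaries as a matrix. -/
def localGate (g : Matrix.unitaryGroup (Fin N) ℂ × Matrix.unitaryGroup (Fin N) ℂ) :
    Matrix (Fin N × Fin N) (Fin N × Fin N) ℂ :=
  (g.1 : Matrix (Fin N) (Fin N) ℂ) ⊗ₖ (g.2 : Matrix (Fin N) (Fin N) ℂ)

lemma localGate_kronecker_mul_star (g : Matrix.unitaryGroup (Fin N) ℂ × Matrix.unitaryGroup (Fin N) ℂ)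
    (z w z' w' : (Fin N × Fin N) × (Fin N × Fin N)) :
    (localGate g ⊗ₖ localGate g) z w * star ((localGate g ⊗ₖ localGate g) z' w') =
      entryMonomial (z.1.1, z.2.1) (w.1.1, w.2.1) (z'.1.1, z'.2.1) (w'.1.1, w'.2.1) g.1 *
      entryMonomial (z.1.2, z.2.2) (w.1.2, w.2.2) (z'.1.2, z'.2.2) (w'.1.2, w'.2.2) g.2 := by
  simp only [localGate, entryMonomial, Matrix.kroneckerMap_apply, star_mul']
  ring

lemma integrable_localGate_moment (μ : Measure (Matrix.unitaryGroup (Fin N) ℂ)) [IsFiniteMeasure μ]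
    (z w z' w' : (Fin N × Fin N) × (Fin N × Fin N)) :
    Integrable (fun g => (localGate g ⊗ₖ localGate g) z w *
      star ((localGate g ⊗ₖ localGate g) z' w')) (μ.prod μ) := by
  simp only [localGate_kronecker_mul_star]
  exact (integrable_entryMonomial μ _ _ _ _).mul_prod (integrable_entryMonomial μ _ _ _ _)

lemma flipParts_eq_iff (s : Bool × Bool) (x y : (Fin N × Fin N) × (Fin N × Fin N)) :
    flipParts s x = y ↔ flipIf s.1 (x.1.1, x.2.1) = (y.1.1, y.2.1) ∧
      flipIf s.2 (x.1.2, x.2.2) = (y.1.2, y.2.2) := by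
  simp only [flipParts, Prod.ext_iff]
  tauto

lemma integral_localGate_moment (hN : 2 ≤ N) (μ : Measure (Matrix.unitaryGroup (Fin N) ℂ))
    [μ.IsHaarMeasure] [IsProbabilityMeasure μ] (z w z' w' : (Fin N × Fin N) × (Fin N × Fin N)) :
    ∫ g, (localGate g ⊗ₖ localGate g) z w * star ((localGate g ⊗ₖ localGate g) z' w')
        ∂(μ.prod μ) =
      ∑ s : Bool × Bool, ∑ t : Bool × Bool, weingarten N s.1 t.1 * weingarten N s.2 t.2 *
        ((if flipParts s z = z' then 1 else 0) * (if flipParts t w = w' then 1 else 0)) := by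
  simp only [localGate_kronecker_mul_star]
  rw [integral_prod_mul, integral_entryMonomial hN, integral_entryMonomial hN]
  simp only [flipParts_eq_iff, Fintype.sum_prod_type, Fintype.sum_bool, ite_and]
  split_ifs <;> ring

lemma pairing_mul_localGate_mul (U V : Matrix (Fin N × Fin N) (Fin N × Fin N) ℂ)
    (g : Matrix.unitaryGroup (Fin N) ℂ × Matrix.unitaryGroup (Fin N) ℂ) (s t : Bool × Bool) :
    pairing (U * localGate g * V) s t =
      ∑ q : (((Fin N × Fin N) × (Fin N × Fin N)) × ((Fin N × Fin N) × (Fin N × Fin N))) ×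
          (((Fin N × Fin N) × (Fin N × Fin N)) × ((Fin N × Fin N) × (Fin N × Fin N))),
        ((∑ x, (U ⊗ₖ U) x q.1.1 * star ((U ⊗ₖ U) (flipParts s x) q.2.1)) *
          (∑ y, (V ⊗ₖ V) q.1.2 y * star ((V ⊗ₖ V) q.2.2 (flipParts t y)))) *
        ((localGate g ⊗ₖ localGate g) q.1.1 q.1.2 *
          star ((localGate g ⊗ₖ localGate g) q.2.1 q.2.2)) := by
  have hM : ∀ x y, ((U * localGate g * V) ⊗ₖ (U * localGate g * V)) x y =
      ∑ r : ((Fin N × Fin N) × (Fin N × Fin N)) × ((Fin N × Fin N) × (Fin N × Fin N)),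
        (U ⊗ₖ U) x r.1 * (localGate g ⊗ₖ localGate g) r.1 r.2 * (V ⊗ₖ V) r.2 y := by
    intro x y
    rw [Matrix.mul_kronecker_mul, Matrix.mul_kronecker_mul, Matrix.mul_apply]
    refine Eq.trans ?_ (Fintype.sum_prod_type_right _).symm
    refine Finset.sum_congr rfl fun w _ => ?_
    rw [Matrix.mul_apply, Finset.sum_mul]
  rw [pairing, Finset.sum_congr rfl fun x _ => Finset.sum_congr rfl fun y _ => by
    rw [hM, hM, star_sum, Finset.sum_mul_sum, ← Fintype.sum_prod_type']]
  rw [Finset.sum_congr rfl fun x _ => Finset.sum_comm, Finset.sum_comm]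
  refine Finset.sum_congr rfl fun q _ => ?_
  rw [Finset.sum_mul_sum, Finset.sum_mul]
  refine Finset.sum_congr rfl fun x _ => ?_
  rw [Finset.sum_mul]
  refine Finset.sum_congr rfl fun y _ => ?_
  simp only [star_mul']
  ring

/-- Averaging over an interlacing local gate contracts the pairings of the outer gates with
Weingarten functions. -/
lemma integral_pairing (hN : 2 ≤ N) (μ : Measure (Matrix.unitaryGroup (Fin N) ℂ))
    [μ.IsHaarMeasure] [IsProbabilityMeasure μ]
    (U V : Matrix (Fin N × Fin N) (Fin N × Fin N) ℂ) (s t : Bool × Bool) :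
    ∫ g, pairing (U * localGate g * V) s t ∂(μ.prod μ) =
      ∑ a : Bool × Bool, ∑ b : Bool × Bool, weingarten N a.1 b.1 * weingarten N a.2 b.2 *
        (pairing U s a * pairing V b t) := by
  simp only [pairing_mul_localGate_mul]
  rw [integral_finsetSum _ fun q _ => (integrable_localGate_moment μ _ _ _ _).const_mul _]
  simp only [integral_const_mul, integral_localGate_moment hN, Finset.mul_sum]
  rw [Finset.sum_comm]
  refine Finset.sum_congr rfl fun a _ => ?_
  rw [Finset.sum_comm]
  refine Finset.sum_congr rfl fun b _ => ?_
  have hU : pairing U s a =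
      ∑ z, ∑ x, (U ⊗ₖ U) x z * star ((U ⊗ₖ U) (flipParts s x) (flipParts a z)) :=
    Finset.sum_comm
  rw [hU, pairing, Finset.sum_mul_sum, Finset.mul_sum, Fintype.sum_prod_type,
    Fintype.sum_prod_type]
  refine Finset.sum_congr rfl fun z _ => ?_
  rw [Finset.mul_sum]
  refine Finset.sum_congr rfl fun w _ => ?_
  rw [Finset.sum_eq_single (flipParts a z, flipParts b w)]
  · simp only [if_true]
    rw [mul_one, mul_one, mul_comm, ← Finset.mul_sum]
  · rintro ⟨z', w'⟩ - hne
    by_cases h1 : flipParts a z = z'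
    · by_cases h2 : flipParts b w = w'
      · exact absurd (by rw [h1, h2]) hne
      · simp [h2]
    · simp [h1]
  · simp

end Pairing

section Purities

variable {N : ℕ}

lemma sum_kronecker_self_row {U : Matrix (Fin N × Fin N) (Fin N × Fin N) ℂ}
    (hU : U ∈ Matrix.unitaryGroup (Fin N × Fin N) ℂ) (x y : (Fin N × Fin N) × (Fin N × Fin N)) :
    ∑ z, (U ⊗ₖ U) x z * star ((U ⊗ₖ U) y z) = if x = y then 1 else 0 := by
  rw [← Matrix.one_apply, ← (Matrix.kronecker_mem_unitary hU hU).2, Matrix.mul_apply]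
  rfl

lemma sum_kronecker_self_col {U : Matrix (Fin N × Fin N) (Fin N × Fin N) ℂ}
    (hU : U ∈ Matrix.unitaryGroup (Fin N × Fin N) ℂ) (x y : (Fin N × Fin N) × (Fin N × Fin N)) :
    ∑ z, (U ⊗ₖ U) z x * star ((U ⊗ₖ U) z y) = if x = y then 1 else 0 := by
  simp only [eq_comm (a := x)]
  rw [← Matrix.one_apply, ← (Matrix.kronecker_mem_unitary hU hU).1, Matrix.mul_apply]
  exact Finset.sum_congr rfl fun z _ => mul_comm _ _

/-- The number of fixed points of a flip of exactly one subsystem. -/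
lemma sum_ite_flipParts (s : Bool) :
    ∑ x : (Fin N × Fin N) × (Fin N × Fin N),
      (if x = flipParts (s, !s) x then (1 : ℂ) else 0) = N ^ 3 := by
  simp only [Fintype.sum_prod_type]
  cases s <;>
  · simp [flipParts, flipIf, eq_comm]
    ring

lemma pairing_false_right {U : Matrix (Fin N × Fin N) (Fin N × Fin N) ℂ}
    (hU : U ∈ Matrix.unitaryGroup (Fin N × Fin N) ℂ) (s : Bool) :
    pairing U (s, !s) (false, false) = N ^ 3 := by
  rw [← sum_ite_flipParts s]
  exact Finset.sum_congr rfl fun x _ => sum_kronecker_self_row hU x _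

lemma pairing_false_left {U : Matrix (Fin N × Fin N) (Fin N × Fin N) ℂ}
    (hU : U ∈ Matrix.unitaryGroup (Fin N × Fin N) ℂ) (s : Bool) :
    pairing U (false, false) (s, !s) = N ^ 3 := by
  rw [← sum_ite_flipParts s, pairing, Finset.sum_comm]
  refine Finset.sum_congr rfl fun x _ => ?_
  rw [eq_comm, ← sum_kronecker_self_col hU]
  rfl

lemma pairing_not (U : Matrix (Fin N × Fin N) (Fin N × Fin N) ℂ) (s t : Bool × Bool) :
    pairing U (!s.1, !s.2) (!t.1, !t.2) = pairing U s t := by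
  have h : ∀ (s : Bool × Bool) (x : (Fin N × Fin N) × (Fin N × Fin N)),
      flipParts (!s.1, !s.2) x = (flipParts s x).swap := by
    rintro ⟨_ | _, _ | _⟩ x <;> rfl
  simp only [pairing, h, Matrix.kroneckerMap_apply, Prod.fst_swap, Prod.snd_swap, mul_comm]

lemma pairing_true_right {U : Matrix (Fin N × Fin N) (Fin N × Fin N) ℂ}
    (hU : U ∈ Matrix.unitaryGroup (Fin N × Fin N) ℂ) (s : Bool) :
    pairing U (s, !s) (true, true) = N ^ 3 := by
  rw [← pairing_not]
  exact pairing_false_right hU (!s)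

lemma pairing_true_left {U : Matrix (Fin N × Fin N) (Fin N × Fin N) ℂ}
    (hU : U ∈ Matrix.unitaryGroup (Fin N × Fin N) ℂ) (s : Bool) :
    pairing U (true, true) (s, !s) = N ^ 3 := by
  rw [← pairing_not]
  exact pairing_false_left hU (!s)

lemma ofReal_re_trace_sq {n : Type*} [Fintype n] {A : Matrix n n ℂ} (hA : A.IsHermitian) :
    (((A * A).trace.re : ℝ) : ℂ) = (A * A).trace := by
  refine Complex.conj_eq_iff_re.1 ?_
  have h : star (A * A).trace = (A * A).trace := by
    rw [← Matrix.trace_conjTranspose, Matrix.conjTranspose_mul, hA.eq]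
  exact h

lemma star_inv_sq (N : ℕ) : star (((N : ℂ) ^ 2)⁻¹) = ((N : ℂ) ^ 2)⁻¹ := by simp

/-- The purity `X` as a contraction. -/
lemma pairing_eq_Xpur (hN : N ≠ 0) (U : Matrix (Fin N × Fin N) (Fin N × Fin N) ℂ) :
    pairing U (true, false) (true, false) = (N : ℂ) ^ 4 * (Xpur N U : ℂ) := by
  have hH : (rhoR N U).IsHermitian := by
    rw [Matrix.IsHermitian, rhoR, Matrix.conjTranspose_smul, star_inv_sq,
      Matrix.conjTranspose_mul, Matrix.conjTranspose_conjTranspose]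
  have hN0 : (N : ℂ) ≠ 0 := by exact_mod_cast hN
  rw [Xpur, ofReal_re_trace_sq hH, rhoR, Matrix.smul_mul, Matrix.mul_smul, Matrix.trace_smul,
    Matrix.trace_smul, smul_eq_mul, smul_eq_mul]
  have h : pairing U (true, false) (true, false) =
      (reshuffle N U * (reshuffle N U)ᴴ * (reshuffle N U * (reshuffle N U)ᴴ)).trace := by
    simp only [pairing, Matrix.trace, Matrix.diag_apply, Matrix.mul_apply, Finset.sum_mul_sum,
      ← Fintype.sum_prod_type']
    refine Fintype.sum_equiv
      ⟨fun z : ((Fin N × Fin N) × (Fin N × Fin N)) × ((Fin N × Fin N) × (Fin N × Fin N)) =>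
        ((z.1.1.1, z.2.1.1), (z.1.2.1, z.2.2.1), (z.1.1.2, z.2.1.2), (z.1.2.2, z.2.2.2)),
       fun z => (((z.1.1, z.2.2.1.1), (z.2.1.1, z.2.2.2.1)),
        ((z.1.2, z.2.2.1.2), (z.2.1.2, z.2.2.2.2))),
       fun _ => rfl, fun _ => rfl⟩ _ _ fun z => ?_
    simp [flipParts, flipIf, reshuffle]
    ring
  rw [h]
  field_simp

lemma swapGate_mul_self : swapGate N * swapGate N = 1 := by
  ext x y
  simp [swapGate, Matrix.mul_apply, Fintype.sum_prod_type, Matrix.one_apply, ite_and, Prod.ext_iff]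

lemma conjTranspose_swapGate : (swapGate N)ᴴ = swapGate N := by
  ext x y
  simp [swapGate, Matrix.conjTranspose_apply, and_comm, eq_comm]

/-- The purity `Y` as a contraction. -/
lemma pairing_eq_Ypur (hN : N ≠ 0) (U : Matrix (Fin N × Fin N) (Fin N × Fin N) ℂ) :
    pairing U (false, true) (true, false) = (N : ℂ) ^ 4 * (Ypur N U : ℂ) := by
  have hH : (rhoT N U).IsHermitian := by
    rw [Matrix.IsHermitian, rhoT, Matrix.conjTranspose_smul, star_inv_sq]
    simp only [Matrix.conjTranspose_mul, Matrix.conjTranspose_conjTranspose,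
      conjTranspose_swapGate, Matrix.mul_assoc]
  have hN0 : (N : ℂ) ≠ 0 := by exact_mod_cast hN
  have hS : ∀ A : Matrix (Fin N × Fin N) (Fin N × Fin N) ℂ,
      (swapGate N * A * swapGate N * (swapGate N * A * swapGate N)).trace = (A * A).trace := by
    intro A
    have : swapGate N * A * swapGate N * (swapGate N * A * swapGate N) =
        swapGate N * (A * (swapGate N * swapGate N) * A * swapGate N) := by
      simp only [Matrix.mul_assoc]
    rw [this, Matrix.trace_mul_comm, Matrix.mul_assoc _ (swapGate N), swapGate_mul_self, mul_one,
      mul_one]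
  rw [Ypur, ofReal_re_trace_sq hH, rhoT, Matrix.smul_mul, Matrix.mul_smul, Matrix.trace_smul,
    Matrix.trace_smul, smul_eq_mul, smul_eq_mul, hS]
  have h : pairing U (false, true) (true, false) =
      (ptransp N U * (ptransp N U)ᴴ * (ptransp N U * (ptransp N U)ᴴ)).trace := by
    simp only [pairing, Matrix.trace, Matrix.diag_apply, Matrix.mul_apply, Finset.sum_mul_sum,
      ← Fintype.sum_prod_type']
    refine Fintype.sum_equiv
      ⟨fun z : ((Fin N × Fin N) × (Fin N × Fin N)) × ((Fin N × Fin N) × (Fin N × Fin N)) =>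
        ((z.2.1.1, z.1.1.2), (z.2.2.1, z.1.2.2), (z.1.1.1, z.2.1.2), (z.1.2.1, z.2.2.2)),
       fun z => (((z.2.2.1.1, z.1.2), (z.2.2.2.1, z.2.1.2)),
        ((z.1.1, z.2.2.1.2), (z.2.1.1, z.2.2.2.2))),
       fun _ => rfl, fun _ => rfl⟩ _ _ fun z => ?_
    simp [flipParts, flipIf, ptransp]
    ring
  rw [h]
  field_simp

end Purities

/-- For unitaries `U, V` on `ℂ^N ⊗ ℂ^N` and independent Haar-random
local unitaries `U^A, U^B` on `ℂ^N`, the Haar averages of the purities of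
`M = U (U^A ⊗ U^B) V` are given by the quoted explicit formulas. -/
theorem purity_average_one_step (N : ℕ) (hN : 2 ≤ N)
    (U V : Matrix (Fin N × Fin N) (Fin N × Fin N) ℂ)
    (hU : U ∈ Matrix.unitaryGroup (Fin N × Fin N) ℂ)
    (hV : V ∈ Matrix.unitaryGroup (Fin N × Fin N) ℂ)
    (μ : Measure (Matrix.unitaryGroup (Fin N) ℂ)) [μ.IsHaarMeasure] [IsProbabilityMeasure μ] :
    (∫ g : Matrix.unitaryGroup (Fin N) ℂ × Matrix.unitaryGroup (Fin N) ℂ,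
        Xpur N (U * (((g.1 : Matrix (Fin N) (Fin N) ℂ)) ⊗ₖ ((g.2 : Matrix (Fin N) (Fin N) ℂ))) * V)
        ∂(μ.prod μ))
      = (((N : ℝ) ^ 2 - 1) ^ 2)⁻¹ *
          (2 * ((N : ℝ) ^ 2 + 1)
            - 2 * (N : ℝ) ^ 2 * (Xpur N U + Ypur N U + Xpur N V + Ypur N V)
            + (N : ℝ) ^ 4 * (Xpur N U * Xpur N V + Ypur N U * Ypur N V)
            + (N : ℝ) ^ 2 * (Ypur N U * Xpur N V + Xpur N U * Ypur N V)) ∧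
    (∫ g : Matrix.unitaryGroup (Fin N) ℂ × Matrix.unitaryGroup (Fin N) ℂ,
        Ypur N (U * (((g.1 : Matrix (Fin N) (Fin N) ℂ)) ⊗ₖ ((g.2 : Matrix (Fin N) (Fin N) ℂ))) * V)
        ∂(μ.prod μ))
      = (((N : ℝ) ^ 2 - 1) ^ 2)⁻¹ *
          (2 * ((N : ℝ) ^ 2 + 1)
            - 2 * (N : ℝ) ^ 2 * (Xpur N U + Ypur N U + Xpur N V + Ypur N V)
            + (N : ℝ) ^ 4 * (Xpur N U * Ypur N V + Ypur N U * Xpur N V)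
            + (N : ℝ) ^ 2 * (Ypur N U * Ypur N V + Xpur N U * Xpur N V)) := by
  have hN0 : N ≠ 0 := by omega
  have hNC : (N : ℂ) ≠ 0 := by exact_mod_cast hN0
  have hN1 : (N : ℂ) ^ 2 - 1 ≠ 0 := by
    rw [sub_ne_zero]
    exact_mod_cast (by nlinarith : N ^ 2 ≠ 1)
  have hX' : ∀ W, pairing W (false, true) (false, true) = (N : ℂ) ^ 4 * (Xpur N W : ℂ) :=
    fun W => (pairing_not W (true, false) (true, false)).trans (pairing_eq_Xpur hN0 W)
  have hY' : ∀ W, pairing W (true, false) (false, true) = (N : ℂ) ^ 4 * (Ypur N W : ℂ) :=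
    fun W => (pairing_not W (false, true) (true, false)).trans (pairing_eq_Ypur hN0 W)
  constructor
  · apply Complex.ofReal_injective
    rw [← integral_complex_ofReal]
    have h := integral_pairing hN μ U V (true, false) (true, false)
    simp only [localGate] at h
    simp only [Fintype.sum_prod_type, Fintype.sum_bool,
      show pairing U (true, false) (false, false) = N ^ 3 from pairing_false_right hU true,
      show pairing U (true, false) (true, true) = N ^ 3 from pairing_true_right hU true,
      show pairing V (false, false) (true, false) = N ^ 3 from pairing_false_left hV true,
      show pairing V (true, true) (true, false) = N ^ 3 from pairing_true_left hV true,
      hY', pairing_eq_Xpur hN0, pairing_eq_Ypur hN0, integral_const_mul] at h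
    apply mul_left_cancel₀ (pow_ne_zero 4 hNC)
    rw [h]
    simp only [weingarten]
    push_cast
    simp
    field_simp
    ring
  · apply Complex.ofReal_injective
    rw [← integral_complex_ofReal]
    have h := integral_pairing hN μ U V (false, true) (true, false)
    simp only [localGate] at h
    simp only [Fintype.sum_prod_type, Fintype.sum_bool,
      show pairing U (false, true) (false, false) = N ^ 3 from pairing_false_right hU false,
      show pairing U (false, true) (true, true) = N ^ 3 from pairing_true_right hU false,
      show pairing V (false, false) (true, false) = N ^ 3 from pairing_false_left hV true,
      show pairing V (true, true) (true, false) = N ^ 3 from pairing_true_left hV true,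
      hX', pairing_eq_Xpur hN0, pairing_eq_Ypur hN0, integral_const_mul] at h
    apply mul_left_cancel₀ (pow_ne_zero 4 hNC)
    rw [h]
    simp only [weingarten]
    push_cast
    simp
    field_simp
    ring
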